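/- Assume Conditions (a) and (b) and Condition P. For ε > 0, fix M = M(ε) such that Σ_{k>M} k·p_k < ε/2 for all n large enough, and let n^ε = (n_1, …, n_M, 0, 0, …) be the truncated type sequence of n(n) (with n_1 decreased by 1 if necessary so that ℓ_{n^ε} is even). Then there exists ε′ > 0 such that for every η > 0 there exists ε″ ∈ (0, ε′] such that for all ε ∈ (0, ε″): liminf_{n→∞} (1/n)·log( |𝒮c_{n(n)}| / |𝒮_{n(n)}^{n^ε}| ) ≥ −η; i.e. |𝒮c_{n(n)}| ≥ e^{δ(ε)n}·|𝒮_{n(n)}^{n^ε}| with δ(ε) → 0 as ε ↓ 0. -/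

import Mathlib

namespace PaperCM

noncomputable section

/-- Number of vertices of a type sequence. -/
def numV (m : ℕ →₀ ℕ) : ℕ := m.sum fun _ c => c

/-- Total degree of a type sequence. -/
def totalDeg (m : ℕ →₀ ℕ) : ℕ := m.sum fun i c => i * c

/-- The nondecreasing degree sequence associated with a type sequence:
`degOf m i` is the least `j` with `m 1 + ⋯ + m j ≥ i + 1` (vertices `0`-indexed). -/
def degOf (m : ℕ →₀ ℕ) (i : ℕ) : ℕ :=
  sInf {j : ℕ | i < ∑ k ∈ Finset.Icc 1 j, m k}

/-- The half-edges of a type sequence: pairs `(v, j)` with `j < d_v`. -/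
abbrev HalfEdges (m : ℕ →₀ ℕ) := Σ v : Fin (numV m), Fin (degOf m (v : ℕ))

/-- A configuration: a perfect matching of the half-edges, encoded as a
fixed-point free involution. -/
def IsConfig (m : ℕ →₀ ℕ) (f : HalfEdges m → HalfEdges m) : Prop :=
  Function.Involutive f ∧ ∀ x, f x ≠ x

/-- Adjacency in the multigraph induced by a configuration. -/
def adj (m : ℕ →₀ ℕ) (f : HalfEdges m → HalfEdges m) (u v : Fin (numV m)) : Prop :=
  ∃ (j : Fin (degOf m (u : ℕ))) (j' : Fin (degOf m (v : ℕ))), f ⟨u, j⟩ = ⟨v, j'⟩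

/-- The multigraph of the configuration is connected. -/
def IsConn (m : ℕ →₀ ℕ) (f : HalfEdges m → HalfEdges m) : Prop :=
  ∀ u v : Fin (numV m), Relation.ReflTransGen (adj m f) u v

/-- The configuration is simple: no self-loops and no multiple edges. -/
def IsSimple (m : ℕ →₀ ℕ) (f : HalfEdges m → HalfEdges m) : Prop :=
  (∀ x : HalfEdges m, (f x).1 ≠ x.1) ∧
    ∀ x y : HalfEdges m, x.1 = y.1 → (f x).1 = (f y).1 → x = y ∨ x = f y

/-- The vertex set of the component of `v`. -/
def component (m : ℕ →₀ ℕ) (f : HalfEdges m → HalfEdges m) (v : Fin (numV m)) :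
    Set (Fin (numV m)) :=
  {u | Relation.ReflTransGen (adj m f) v u}

/-- The type of the component of `v`: the number of its vertices of each degree. -/
def compType (m : ℕ →₀ ℕ) (f : HalfEdges m → HalfEdges m) (v : Fin (numV m)) (i : ℕ) : ℕ :=
  Set.ncard {u : Fin (numV m) | u ∈ component m f v ∧ degOf m (u : ℕ) = i}

/-- The configuration has a component with type `m'`. -/
def HasCompOfType (m : ℕ →₀ ℕ) (f : HalfEdges m → HalfEdges m) (m' : ℕ →₀ ℕ) : Prop :=
  ∃ v : Fin (numV m), ∀ i, compType m f v i = m' i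

/-- `v` is the minimal representative of its component. -/
def IsRep (m : ℕ →₀ ℕ) (f : HalfEdges m → HalfEdges m) (v : Fin (numV m)) : Prop :=
  ∀ u ∈ component m f v, v ≤ u

/-- Number of components of the configuration whose type lies in `𝒩`. -/
def numCompIn (m : ℕ →₀ ℕ) (f : HalfEdges m → HalfEdges m) (𝒩 : Set (ℕ →₀ ℕ)) : ℕ :=
  Set.ncard {v : Fin (numV m) | IsRep m f v ∧ ∃ m' ∈ 𝒩, ∀ i, compType m f v i = m' i}

/-- `|𝒞_m|`: the number of configurations with type `m`. -/
def cC (m : ℕ →₀ ℕ) : ℕ := Set.ncard {f | IsConfig m f}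
/-- `|𝒞c_m|`: the number of connected configurations with type `m`. -/
def cCc (m : ℕ →₀ ℕ) : ℕ := Set.ncard {f | IsConfig m f ∧ IsConn m f}
/-- `|𝒮_m|`: the number of simple configurations with type `m`. -/
def cS (m : ℕ →₀ ℕ) : ℕ := Set.ncard {f | IsConfig m f ∧ IsSimple m f}
/-- `|𝒮c_m|`: the number of connected simple configurations with type `m`. -/
def cSc (m : ℕ →₀ ℕ) : ℕ := Set.ncard {f | IsConfig m f ∧ IsSimple m f ∧ IsConn m f}
/-- `|𝒞_m^{m'}|`: configurations with type `m` having a component of type `m'`. -/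
def cCcomp (m m' : ℕ →₀ ℕ) : ℕ := Set.ncard {f | IsConfig m f ∧ HasCompOfType m f m'}
/-- `|𝒮_m^{m'}|`. -/
def cScomp (m m' : ℕ →₀ ℕ) : ℕ :=
  Set.ncard {f | IsConfig m f ∧ IsSimple m f ∧ HasCompOfType m f m'}
/-- `|𝒞_m^{𝒩}|`: configurations with type `m` having a component whose type lies in `𝒩`. -/
def cCcompSet (m : ℕ →₀ ℕ) (𝒩 : Set (ℕ →₀ ℕ)) : ℕ :=
  Set.ncard {f | IsConfig m f ∧ ∃ m' ∈ 𝒩, HasCompOfType m f m'}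
/-- `|𝒮_m^{𝒩}|`. -/
def cScompSet (m : ℕ →₀ ℕ) (𝒩 : Set (ℕ →₀ ℕ)) : ℕ :=
  Set.ncard {f | IsConfig m f ∧ IsSimple m f ∧ ∃ m' ∈ 𝒩, HasCompOfType m f m'}

/-- The type sequence `n(n) = (n_i(n))_{i ≥ 1}` of the degree sequence `d(n)`. -/
def typeOf (d : (n : ℕ) → Fin n → ℕ) (n : ℕ) : ℕ →₀ ℕ :=
  ∑ j : Fin n, Finsupp.single (d n j) 1

/-- The total degree `ℓ_n = Σ_i i·n_i = Σ_j d_j(n)`. -/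
def ℓTot (d : (n : ℕ) → Fin n → ℕ) (n : ℕ) : ℕ := ∑ j : Fin n, d n j

/-- The set `𝒩^ε(n)` of type sequences approximating `n` from below. -/
def Neps (ε : ℝ) (nn : ℕ →₀ ℕ) : Set (ℕ →₀ ℕ) :=
  {m | m ≤ nn ∧ (1 - ε) * (totalDeg nn : ℝ) < (totalDeg m : ℝ)}

/-- `β(p)`: the solution in `(0,1)` of the fixed-point equation
`Σ_k k p_k = (1-β²) Σ_k k p_k/(1-β^k)`. -/
def betaOf (p : ℕ → ℝ) : ℝ :=
  sInf {β : ℝ | β ∈ Set.Ioo 0 1 ∧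
    ∑' k : ℕ, (k : ℝ) * p k = (1 - β ^ 2) * ∑' k : ℕ, (k : ℝ) * p k / (1 - β ^ k)}

/-- The exponential rate `K(p)`. -/
def Kof (p : ℕ → ℝ) : ℝ :=
  (∑' k : ℕ, (k : ℝ) * p k) / 2 * Real.log (1 - betaOf p ^ 2)
    - ∑' k : ℕ, p k * Real.log (1 - betaOf p ^ k)

end

end PaperCM

namespace PaperCM

section Switching

variable {V H : Type*}

/-- Adjacency of vertices along the edges of `f` that avoid the half-edges in `D`. -/
def AdjOff (π : H → V) (f : H → H) (D : Set H) (u v : V) : Prop :=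
  ∃ x, x ∉ D ∧ f x ∉ D ∧ π x = u ∧ π (f x) = v

/-- Connection of vertices along the edges of `f` that avoid the half-edges in `D`. -/
abbrev ConnOff (π : H → V) (f : H → H) (D : Set H) : V → V → Prop :=
  Relation.ReflTransGen (AdjOff π f D)

lemma AdjOff.symm {π : H → V} {f : H → H} (hf : Function.Involutive f) {D : Set H} {u v : V}
    (h : AdjOff π f D u v) : AdjOff π f D v u := by
  obtain ⟨x, hx, hfx, hu, hv⟩ := h
  exact ⟨f x, hfx, by rwa [hf x], hv, by rwa [hf x]⟩

lemma ConnOff.symm {π : H → V} {f : H → H} (hf : Function.Involutive f) {D : Set H} {u v : V}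
    (h : ConnOff π f D u v) : ConnOff π f D v u := by
  induction h with
  | refl => exact .refl
  | tail _ h ih => exact .head (h.symm hf) ih

lemma ConnOff.edge {π : H → V} {f : H → H} (x : H) : ConnOff π f ∅ (π x) (π (f x)) :=
  .single ⟨x, id, id, rfl, rfl⟩

/-- In a loopless component all of whose vertices other than `r` have degree at least two,
some edge can be deleted without disconnecting the component. -/
lemma exists_nonseparating [Finite V] (π : H → V) (f : H → H) (hf : Function.Involutive f)
    (hl : ∀ x, π (f x) ≠ π x) (r : V) (hr : ∃ x, π x = r)
    (hdeg : ∀ u, ConnOff π f ∅ r u → u ≠ r → ∃ x y, x ≠ y ∧ π x = u ∧ π y = u) :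
    ∃ s, ConnOff π f ∅ r (π s) ∧ π s ≠ r ∧ ∀ u, ConnOff π f ∅ r u → ConnOff π f {s, f s} r u := by
  let G : SimpleGraph V :=
    { Adj := AdjOff π f ∅
      symm := ⟨fun u v h => h.symm hf⟩
      loopless := ⟨fun u h => by
        obtain ⟨x, -, -, h1, h2⟩ := h
        exact hl x (h2.trans h1.symm)⟩ }
  have hG : ∀ u, G.Reachable r u ↔ ConnOff π f ∅ r u := fun u =>
    SimpleGraph.reachable_iff_reflTransGen r u
  obtain ⟨x₀, hx₀⟩ := hr
  obtain ⟨w, hw, hmax⟩ := Set.exists_max_image {u | G.Reachable r u} (G.dist r) (Set.toFinite _)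
    ⟨r, SimpleGraph.Reachable.refl r⟩
  have hwr : w ≠ r := by
    rintro rfl
    have hadj : G.Adj w (π (f x₀)) := ⟨x₀, id, id, hx₀, rfl⟩
    have h1 := hmax _ hadj.reachable
    have h2 := hadj.reachable.pos_dist_of_ne hadj.ne
    rw [SimpleGraph.dist_self] at h1
    omega
  obtain ⟨x, y, hxy, hx, hy⟩ := hdeg w ((hG w).1 hw) hwr
  refine ⟨x, by rw [hx]; exact (hG w).1 hw, by rwa [hx], ?_⟩
  have key : ∀ k u, G.Reachable r u → G.dist r u = k → u ≠ w → ConnOff π f {x, f x} r u := by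
    intro k
    induction k with
    | zero =>
      intro u hu h0 _
      rw [hu.dist_eq_zero_iff] at h0
      subst h0
      exact .refl
    | succ k ih =>
      intro u hu hk huw
      obtain ⟨p, hp⟩ := hu.symm.exists_walk_length_eq_dist
      rw [SimpleGraph.dist_comm, hk] at hp
      cases p with
      | nil => simp at hp
      | @cons _ v _ hadj q =>
        simp only [SimpleGraph.Walk.length_cons, Nat.add_right_cancel_iff] at hp
        have hv : G.Reachable r v := q.reachable.symm
        have hd1 : G.dist r v ≤ k := by
          rw [SimpleGraph.dist_comm, ← hp]; exact SimpleGraph.dist_le q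
        have hd2 : k + 1 ≤ G.dist r v + 1 := by
          obtain ⟨q', hq'⟩ := hv.exists_walk_length_eq_dist
          rw [← hk, ← hq']
          have := SimpleGraph.dist_le (q'.concat hadj.symm)
          rwa [SimpleGraph.Walk.length_concat] at this
        have hvw : v ≠ w := by
          rintro rfl
          have := hmax u hu
          omega
        refine (ih v hv (by omega) hvw).tail ?_
        obtain ⟨z, -, -, hz1, hz2⟩ := hadj
        refine AdjOff.symm hf ⟨z, ?_, ?_, hz1, hz2⟩
        · rintro (rfl | rfl)
          · exact huw (hz1.symm.trans hx)
          · rw [hf x] at hz2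
            exact hvw (hz2.symm.trans hx)
        · rintro (h | h)
          · rw [h] at hz2
            exact hvw (hz2.symm.trans hx)
          · rw [hf.injective h] at hz1
            exact huw (hz1.symm.trans hx)
  intro u hu
  by_cases huw : u = w
  · subst huw
    have hne : π (f y) ≠ u := fun h => hl y (h.trans hy.symm)
    have hadj : G.Adj u (π (f y)) := ⟨y, id, id, hy, rfl⟩
    refine (key _ (π (f y)) (hw.trans hadj.reachable) rfl hne).tail
      (AdjOff.symm hf ⟨y, ?_, ?_, hy, rfl⟩)
    · rintro (h | h)
      · exact hxy h.symm
      · rw [h] at hy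
        exact hl x (hy.trans hx.symm)
    · rintro (h | h)
      · rw [h] at hne
        exact hne hx
      · exact hxy (hf.injective h).symm
  · exact key _ u ((hG u).2 hu) rfl huw

/-- A choice of one half-edge per component, such that its edge is nonseparating unless the
component is the one of `a`. -/
lemma exists_selection [Finite V] (π : H → V) (f : H → H) (hf : Function.Involutive f)
    (hl : ∀ x, π (f x) ≠ π x) (hπ : Function.Surjective π) (a r₀ : V)
    (hdeg : ∀ u, ¬ ConnOff π f ∅ a u → u ≠ r₀ → ∃ x y, x ≠ y ∧ π x = u ∧ π y = u) :
    ∃ s : V → H, (∀ u, ConnOff π f ∅ u (π (s u))) ∧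
      (∀ u v, ConnOff π f ∅ u v → s u = s v) ∧
      ∀ u, ¬ ConnOff π f ∅ a u →
        (∀ v, ConnOff π f ∅ u v → ConnOff π f {s u, f (s u)} (π (s u)) v) ∧
        ∃ x, x ≠ s u ∧ π x = π (s u) := by
  classical
  let St : Setoid V := ⟨ConnOff π f ∅, fun _ => .refl, fun h => h.symm hf, fun h h' => h.trans h'⟩
  have hout : ∀ u, ConnOff π f ∅ u (Quotient.out (Quotient.mk St u)) := fun u =>
    ConnOff.symm hf (Quotient.mk_out (s := St) u)
  have hQ : ∀ q : Quotient St, ∃ s : H, ConnOff π f ∅ q.out (π s) ∧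
      (¬ ConnOff π f ∅ a q.out →
        (∀ v, ConnOff π f ∅ q.out v → ConnOff π f {s, f s} (π s) v) ∧
        ∃ x, x ≠ s ∧ π x = π s) := by
    intro q
    by_cases hq : ConnOff π f ∅ a q.out
    · obtain ⟨s, hs⟩ := hπ q.out
      exact ⟨s, by rw [hs], fun h => absurd hq h⟩
    · obtain ⟨r, hr, hr'⟩ : ∃ r, ConnOff π f ∅ q.out r ∧
          (ConnOff π f ∅ q.out r₀ → r = r₀) := by
        by_cases h : ConnOff π f ∅ q.out r₀
        · exact ⟨r₀, h, fun _ => rfl⟩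
        · exact ⟨q.out, .refl, fun h' => absurd h' h⟩
      have hd : ∀ u, ConnOff π f ∅ r u → u ≠ r → ∃ x y, x ≠ y ∧ π x = u ∧ π y = u := by
        intro u hu hur
        refine hdeg u (fun h => hq (h.trans (ConnOff.symm hf (hr.trans hu)))) ?_
        rintro rfl
        exact hur (hr' (hr.trans hu)).symm
      obtain ⟨s, hs, hsr, hsep⟩ := exists_nonseparating π f hf hl r (hπ r) hd
      refine ⟨s, hr.trans hs, fun _ => ⟨fun v hv => ?_, ?_⟩⟩
      · exact ((hsep _ hs).symm hf).trans (hsep v ((hr.symm hf).trans hv))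
      · obtain ⟨x, y, hxy, hx, hy⟩ := hd _ hs hsr
        by_cases h : x = s
        · exact ⟨y, fun h' => hxy (h.trans h'.symm), hy⟩
        · exact ⟨x, h, hx⟩
  choose t ht1 ht2 using hQ
  refine ⟨fun u => t (Quotient.mk St u), fun u => (hout u).trans (ht1 _), fun u v h => ?_,
    fun u hu => ?_⟩
  · exact congrArg t (Quotient.sound (s := St) h)
  · obtain ⟨h1, h2⟩ := ht2 (Quotient.mk St u) fun h => hu (h.trans ((hout u).symm hf))
    exact ⟨fun v hv => h1 v (((hout u).symm hf).trans hv), h2⟩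

/-- Conjugating by a cyclic permutation of a system `S` of half-edges, one per component, keeps
the configuration simple. -/
lemma conj_simple (π : H → V) (f : H → H) (hf : Function.Involutive f)
    (hl : ∀ x, π (f x) ≠ π x)
    (hm : ∀ x y, π x = π y → π (f x) = π (f y) → x = y ∨ x = f y)
    (S : Set H) (hS : ∀ s ∈ S, ∀ t ∈ S, ConnOff π f ∅ (π s) (π t) → s = t)
    (ρ : Equiv.Perm H) (hρ : ∀ z, ρ z ∈ S ↔ z ∈ S) (hρ' : ∀ z ∉ S, ρ z = z)
    (g : H → H) (hg : ∀ z, g (ρ z) = ρ (f z)) :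
    (∀ x, π (g x) ≠ π x) ∧ ∀ x y, π x = π y → π (g x) = π (g y) → x = y ∨ x = g y := by
  have hcl : ∀ {x y}, π x = π y → ConnOff π f ∅ (π x) (π y) := fun h => by rw [h]
  have hfS : ∀ s ∈ S, f s ∉ S := fun s hs h => by
    have := hS s hs _ h (ConnOff.edge s)
    exact hl s (by rw [← this])
  have hgf : ∀ s ∈ S, g (f s) = ρ s := fun s hs => by
    have := hg (f s)
    rwa [hρ' _ (hfS s hs), hf s] at this
  have hgρ : ∀ s ∈ S, g (ρ s) = f s := fun s hs => by
    rw [hg, hρ' _ (hfS s hs)]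
  have hgo : ∀ z, z ∉ S → f z ∉ S → g z = f z := fun z hz hfz => by
    have := hg z
    rwa [hρ' _ hz, hρ' _ hfz] at this
  have hcase : ∀ z, (∃ s ∈ S, z = f s) ∨ (∃ s ∈ S, z = ρ s) ∨ (z ∉ S ∧ f z ∉ S) := by
    intro z
    by_cases h1 : f z ∈ S
    · exact Or.inl ⟨f z, h1, (hf z).symm⟩
    · by_cases h2 : z ∈ S
      · refine Or.inr (Or.inl ⟨ρ.symm z, ?_, by simp⟩)
        rw [← hρ]; simpa using h2
      · exact Or.inr (Or.inr ⟨h2, h1⟩)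
  have hff : ∀ x, ConnOff π f ∅ (π (f x)) (π x) := fun x => (ConnOff.edge x).symm hf
  have hfix : ∀ s ∈ S, ConnOff π f ∅ (π (ρ s)) (π s) → ρ s = s := fun s hs h =>
    hS _ ((hρ s).2 hs) s hs h
  have hloop : ∀ s ∈ S, π (ρ s) ≠ π (f s) := fun s hs h => by
    have h1 := hfix s hs ((hcl h).trans (hff s))
    rw [h1] at h
    exact hl s h.symm
  refine ⟨fun z => ?_, fun z z' h h' => ?_⟩
  · rcases hcase z with ⟨s, hs, rfl⟩ | ⟨s, hs, rfl⟩ | ⟨h1, h2⟩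
    · rw [hgf s hs]; exact hloop s hs
    · rw [hgρ s hs]; exact (hloop s hs).symm
    · rw [hgo z h1 h2]; exact hl z
  · have mixed : ∀ s ∈ S, ∀ t, t ∉ S → f t ∉ S → π (f s) = π t → π (ρ s) ≠ π (f t) := by
      intro s hs t ht hft h1 h2
      have h3 := hfix s hs ((hcl h2).trans ((hff t).trans ((hcl h1.symm).trans (hff s))))
      rw [h3] at h2
      rcases hm (f s) t h1 (by rw [hf s, h2]) with h4 | h4
      · rw [← h4, hf s] at hft
        exact hft hs
      · rw [← hf.injective h4] at ht
        exact ht hs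
    rcases hcase z with ⟨s, hs, rfl⟩ | ⟨s, hs, rfl⟩ | ⟨h1, h2⟩ <;>
    rcases hcase z' with ⟨t, ht, rfl⟩ | ⟨t, ht, rfl⟩ | ⟨h3, h4⟩
    · left
      rw [hS s hs t ht ((ConnOff.edge s).trans ((hcl h).trans (hff t)))]
    · have := hS s hs _ ((hρ t).2 ht) ((ConnOff.edge s).trans (hcl h))
      rw [← this] at h
      exact absurd h (hl s)
    · rw [hgf s hs, hgo z' h3 h4] at h'
      exact absurd h' (mixed s hs z' h3 h4 h)
    · have := hS t ht _ ((hρ s).2 hs) ((ConnOff.edge t).trans (hcl h.symm))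
      rw [← this] at h
      exact absurd h.symm (hl t)
    · left
      exact hS _ ((hρ s).2 hs) _ ((hρ t).2 ht) (hcl h)
    · rw [hgρ s hs, hgo z' h3 h4] at h'
      exact absurd (h.trans (by rw [hf z'])) (mixed s hs (f z') h4 (by rwa [hf z']) h')
    · rw [hgf t ht, hgo z h1 h2] at h'
      exact absurd h'.symm (mixed t ht z h1 h2 h.symm)
    · rw [hgρ t ht, hgo z h1 h2] at h'
      exact absurd (h.symm.trans (by rw [hf z])) (mixed t ht (f z) h2 (by rwa [hf z]) h'.symm)
    · rw [hgo z h1 h2, hgo z' h3 h4] at h'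
      rw [hgo z' h3 h4]
      exact hm z z' h h'

/-- Conjugating by a cyclic permutation of a system `S` of half-edges, one per component, with
at most one separating edge, makes the configuration connected. -/
lemma conj_connected (π : H → V) (f : H → H) (hf : Function.Involutive f)
    (hl : ∀ x, π (f x) ≠ π x)
    (S : Finset H) (hS : ∀ s ∈ S, ∀ t ∈ S, ConnOff π f ∅ (π s) (π t) → s = t)
    (hcover : ∀ u, ∃ s ∈ S, ConnOff π f ∅ u (π s)) (b : H) (hb : b ∈ S)
    (hsep : ∀ s ∈ S, s ≠ b → ∀ u, ConnOff π f ∅ (π s) u → ConnOff π f {s, f s} (π s) u)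
    (ρ : Equiv.Perm H) (hρ : ρ.IsCycleOn S) (hρ' : ∀ z ∉ S, ρ z = z)
    (g : H → H) (hgi : Function.Involutive g) (hg : ∀ z, g (ρ z) = ρ (f z)) (u v : V) :
    ConnOff π g ∅ u v := by
  have hfS : ∀ s ∈ S, f s ∉ S := fun s hs h => by
    have := hS s hs _ h (ConnOff.edge s)
    exact hl s (by rw [← this])
  have hgf : ∀ s ∈ S, g (f s) = ρ s := fun s hs => by
    have := hg (f s)
    rwa [hρ' _ (hfS s hs), hf s] at this
  have hgo : ∀ z, z ∉ S → f z ∉ S → g z = f z := fun z hz hfz => by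
    have := hg z
    rwa [hρ' _ hz, hρ' _ hfz] at this
  have hedge : ∀ s ∈ S, ConnOff π g ∅ (π (f s)) (π (ρ s)) := fun s hs => by
    have := ConnOff.edge (π := π) (f := g) (f s)
    rwa [hgf s hs] at this
  have hstay : ∀ s ∈ S, ∀ z, ConnOff π f ∅ (π s) (π z) → z ≠ s → z ≠ f s → g z = f z := by
    intro s hs z hz h1 h2
    refine hgo z (fun h => h1 (hS s hs z h hz).symm) fun h => h2 ?_
    rw [hS s hs _ h (hz.trans (ConnOff.edge z)), hf z]
  have hkeep : ∀ s ∈ S, ∀ u, ConnOff π f {s, f s} (π s) u →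
      ConnOff π f ∅ (π s) u ∧ ConnOff π g ∅ (π s) u := by
    intro s hs u hu
    induction hu with
    | refl => exact ⟨.refl, .refl⟩
    | tail _ h ih =>
      obtain ⟨z, h1, h2, rfl, rfl⟩ := h
      simp only [Set.mem_insert_iff, Set.mem_singleton_iff, not_or] at h1
      refine ⟨ih.1.trans (ConnOff.edge z), ih.2.trans ?_⟩
      rw [← hstay s hs z ih.1 h1.1 h1.2]
      exact ConnOff.edge z
  have hpow : ∀ n : ℕ, ConnOff π g ∅ (π (f b)) (π ((ρ ^ n) (ρ b))) := by
    intro n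
    induction n with
    | zero => simpa using hedge b hb
    | succ n ih =>
      have hs : (ρ ^ n) (ρ b) ∈ S := by
        have := (hρ.1.perm_pow n).mapsTo (hρ.1.mapsTo hb)
        simpa using this
      have hnext : (ρ ^ (n + 1)) (ρ b) = ρ ((ρ ^ n) (ρ b)) := by
        rw [pow_succ']; rfl
      rw [hnext]
      set s := (ρ ^ n) (ρ b)
      by_cases hsb : s = b
      · rw [hsb]; exact hedge b hb
      · exact (ih.trans (hkeep s hs _ (hsep s hs hsb _ (ConnOff.edge s))).2).trans (hedge s hs)
  have hall : ∀ s ∈ S, ConnOff π g ∅ (π (f b)) (π s) := by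
    intro s hs
    obtain ⟨n, -, hn⟩ := hρ.exists_pow_eq (hρ.1.mapsTo hb) hs
    rw [← hn]; exact hpow n
  have hbase : ∀ u, ConnOff π f ∅ (π b) u → ConnOff π g ∅ (π (f b)) u := by
    intro u hu
    induction hu with
    | refl => exact hall b hb
    | tail h1 h ih =>
      obtain ⟨z, -, -, rfl, rfl⟩ := h
      by_cases hz1 : z = b
      · rw [hz1]
      · by_cases hz2 : z = f b
        · rw [hz2, hf b]; exact hall b hb
        · refine ih.trans ?_
          rw [← hstay b hb z h1 hz1 hz2]
          exact ConnOff.edge z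
  have hany : ∀ u, ConnOff π g ∅ (π (f b)) u := by
    intro u
    obtain ⟨s, hs, hus⟩ := hcover u
    by_cases hsb : s = b
    · subst hsb
      exact hbase u (hus.symm hf)
    · exact (hall s hs).trans (hkeep s hs u (hsep s hs hsb u (hus.symm hf))).2
  exact ((hany u).symm hgi).trans (hany v)

/-- A cyclic permutation of a finite set `S`, depending on `S` only. -/
noncomputable def cyclePerm [DecidableEq H] [Fintype H] (S : Finset H) : Equiv.Perm H :=
  (Finset.exists_cycleOn S).choose

lemma cyclePerm_isCycleOn [DecidableEq H] [Fintype H] (S : Finset H) :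
    (cyclePerm S).IsCycleOn S :=
  (Finset.exists_cycleOn S).choose_spec.1

lemma cyclePerm_apply_of_notMem [DecidableEq H] [Fintype H] (S : Finset H) {z : H}
    (hz : z ∉ S) : cyclePerm S z = z := by
  by_contra h
  exact hz ((Finset.exists_cycleOn S).choose_spec.2 (Equiv.Perm.mem_support.2 h))

/-- A simple configuration whose vertices outside the component of `a` have degree at least two,
with at most one exception `r₀`, is conjugate to a connected simple configuration. -/
lemma exists_conj_connected_simple [Finite V] [DecidableEq H] [Fintype H]
    (π : H → V) (f : H → H) (hf : Function.Involutive f)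
    (hl : ∀ x, π (f x) ≠ π x)
    (hm : ∀ x y, π x = π y → π (f x) = π (f y) → x = y ∨ x = f y)
    (hπ : Function.Surjective π) (a r₀ : V)
    (hdeg : ∀ u, ¬ ConnOff π f ∅ a u → u ≠ r₀ → ∃ x y, x ≠ y ∧ π x = u ∧ π y = u)
    (B : Finset H)
    (hB : ∀ x y, x ≠ y → π x = π y → ¬ ConnOff π f ∅ a (π x) → x ∈ B) :
    ∃ (b : H) (X : Finset H) (g : H → H), X ⊆ B ∧
      f = (cyclePerm (insert b X)).symm ∘ g ∘ cyclePerm (insert b X) ∧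
      Function.Involutive g ∧ (∀ x, π (g x) ≠ π x) ∧
      (∀ x y, π x = π y → π (g x) = π (g y) → x = y ∨ x = g y) ∧
      ∀ u v, ConnOff π g ∅ u v := by
  classical
  have := Fintype.ofFinite V
  obtain ⟨s, hs1, hs2, hs3⟩ := exists_selection π f hf hl hπ a r₀ hdeg
  have hss : ∀ u, s (π (s u)) = s u := fun u => (hs2 _ _ (hs1 u)).symm
  let S : Finset H := Finset.univ.image s
  have hmem : ∀ x ∈ S, s (π x) = x := by
    intro x hx
    obtain ⟨u, -, rfl⟩ := Finset.mem_image.1 hx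
    exact hss u
  have hna : ∀ x ∈ S, x ≠ s a → ¬ ConnOff π f ∅ a (π x) := fun x hx hxa h =>
    hxa ((hmem x hx).symm.trans (hs2 _ _ h).symm)
  have haS : s a ∈ S := Finset.mem_image_of_mem _ (Finset.mem_univ _)
  have hins : insert (s a) (S.erase (s a)) = S := Finset.insert_erase haS
  refine ⟨s a, S.erase (s a), cyclePerm S ∘ f ∘ (cyclePerm S).symm, ?_, ?_, ?_⟩
  · intro x hx
    obtain ⟨hxa, hx⟩ := Finset.mem_erase.1 hx
    have h := hna x hx hxa
    obtain ⟨y, hy, hy'⟩ := (hs3 (π x) h).2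
    rw [hmem x hx] at hy hy'
    exact hB x y hy.symm hy'.symm h
  · rw [hins]; ext z; simp
  · have hSinj : ∀ x ∈ S, ∀ y ∈ S, ConnOff π f ∅ (π x) (π y) → x = y := fun x hx y hy h => by
      rw [← hmem x hx, ← hmem y hy, hs2 _ _ h]
    have hgi : Function.Involutive (cyclePerm S ∘ f ∘ (cyclePerm S).symm) := fun z => by
      simp [hf _]
    obtain ⟨h1, h2⟩ := conj_simple π f hf hl hm S hSinj (cyclePerm S)
      (fun z => (cyclePerm_isCycleOn S).apply_mem_iff)
      (fun z hz => cyclePerm_apply_of_notMem S hz)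
      (cyclePerm S ∘ f ∘ (cyclePerm S).symm) (fun z => by simp)
    refine ⟨hgi, h1, h2, conj_connected π f hf hl S hSinj
      (fun u => ⟨s u, Finset.mem_image_of_mem _ (Finset.mem_univ _), hs1 u⟩) (s a) haS
      (fun x hx hxa u hu => ?_) (cyclePerm S) (cyclePerm_isCycleOn S)
      (fun z hz => cyclePerm_apply_of_notMem S hz) _ hgi (fun z => by simp)⟩
    have h := (hs3 (π x) (hna x hx hxa)).1 u hu
    rwa [hmem x hx] at h

end Switching

section Counting

lemma lt_sum_degOf (m : ℕ →₀ ℕ) (hm0 : m 0 = 0) {u : ℕ} (hu : u < numV m) :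
    u < ∑ k ∈ Finset.Icc 1 (degOf m u), m k := by
  have hne : {j : ℕ | u < ∑ k ∈ Finset.Icc 1 j, m k}.Nonempty := by
    refine ⟨m.support.sup id, lt_of_lt_of_le hu ?_⟩
    refine Finset.sum_le_sum_of_subset fun k hk => Finset.mem_Icc.2 ⟨?_, ?_⟩
    · rcases Nat.eq_zero_or_pos k with rfl | h
      · exact absurd hm0 (Finsupp.mem_support_iff.1 hk)
      · exact h
    · exact Finset.le_sup (f := id) hk
  exact Nat.sInf_mem hne

lemma sum_le_of_lt_degOf (m : ℕ →₀ ℕ) {u j : ℕ} (hj : j < degOf m u) :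
    ∑ k ∈ Finset.Icc 1 j, m k ≤ u :=
  not_lt.1 (Nat.notMem_of_lt_sInf (s := {j : ℕ | u < ∑ k ∈ Finset.Icc 1 j, m k}) hj)

lemma degOf_pos (m : ℕ →₀ ℕ) (hm0 : m 0 = 0) {u : ℕ} (hu : u < numV m) : 0 < degOf m u := by
  by_contra h
  have := lt_sum_degOf m hm0 hu
  simp [Nat.eq_zero_of_not_pos h] at this

lemma card_degOf_eq_le (m : ℕ →₀ ℕ) (hm0 : m 0 = 0) (i : ℕ) :
    (Finset.univ.filter fun u : Fin (numV m) => degOf m (u : ℕ) = i).card ≤ m i := by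
  cases i with
  | zero =>
    rw [Finset.filter_false_of_mem fun u _ => (degOf_pos m hm0 u.2).ne']
    simp
  | succ i =>
    have h : m (i + 1) = (Finset.Ico (∑ k ∈ Finset.Icc 1 i, m k)
        (∑ k ∈ Finset.Icc 1 (i + 1), m k)).card := by
      rw [Nat.card_Ico, Finset.sum_Icc_succ_top (by omega)]
      omega
    rw [h]
    refine Finset.card_le_card_of_injOn (fun u => (u : ℕ)) (fun u hu => ?_)
      (fun _ _ _ _ h => Fin.ext h)
    have hu' : degOf m (u : ℕ) = i + 1 := by simpa using hu
    refine Finset.mem_coe.2 (Finset.mem_Ico.2 ⟨sum_le_of_lt_degOf m (hu'.symm ▸ Nat.lt_succ_self i), ?_⟩)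
    rw [← hu']
    exact lt_sum_degOf m hm0 u.2

/-- The half-edges at vertices of degree larger than `M`. -/
noncomputable def bigHalfEdges (m : ℕ →₀ ℕ) (M : ℕ) : Finset (HalfEdges m) :=
  Finset.univ.filter fun x => M < degOf m (x.1 : ℕ)

lemma card_bigHalfEdges_add_le (m : ℕ →₀ ℕ) (hm0 : m 0 = 0) (M : ℕ) :
    (bigHalfEdges m M).card + ∑ k ∈ Finset.range (M + 1), k * m k ≤ totalDeg m := by
  have h1 : (bigHalfEdges m M).card ≤ ∑ k ∈ m.support.filter (M < ·), k * m k := by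
    have hmaps : ∀ x ∈ bigHalfEdges m M, degOf m (x.1 : ℕ) ∈ m.support.filter (M < ·) := by
      intro x hx
      refine Finset.mem_filter.2 ⟨Finsupp.mem_support_iff.2 fun h => ?_, by
        simpa [bigHalfEdges] using hx⟩
      have := card_degOf_eq_le m hm0 (degOf m (x.1 : ℕ))
      rw [h, Nat.le_zero, Finset.card_eq_zero] at this
      have hx' : x.1 ∈ (Finset.univ.filter
          fun u : Fin (numV m) => degOf m (u : ℕ) = degOf m (x.1 : ℕ)) := by simp
      rw [this] at hx'
      simp at hx'
    rw [Finset.card_eq_sum_card_fiberwise hmaps]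
    refine Finset.sum_le_sum fun k _ => ?_
    have hsub : (bigHalfEdges m M).filter (fun x => degOf m (x.1 : ℕ) = k) ⊆
        (Finset.univ.filter fun u : Fin (numV m) => degOf m (u : ℕ) = k).sigma
          fun _ => Finset.univ := by
      intro x hx
      simpa using (Finset.mem_filter.1 hx).2
    refine (Finset.card_le_card hsub).trans ?_
    rw [Finset.card_sigma, Finset.sum_congr rfl (g := fun _ => k) fun u hu => by
      simpa using (Finset.mem_filter.1 hu).2, Finset.sum_const, smul_eq_mul, mul_comm]
    exact Nat.mul_le_mul_left _ (card_degOf_eq_le m hm0 k)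
  have h2 : ∑ k ∈ Finset.range (M + 1), k * m k =
      ∑ k ∈ m.support.filter (¬ M < ·), k * m k := by
    symm
    refine Finset.sum_subset (fun k hk => ?_) fun k hk hk' => ?_
    · have := (Finset.mem_filter.1 hk).2
      exact Finset.mem_range.2 (by omega)
    · have h3 : m k = 0 := by
        by_contra h
        refine hk' (Finset.mem_filter.2 ⟨Finsupp.mem_support_iff.2 h, ?_⟩)
        have := Finset.mem_range.1 hk
        omega
      rw [h3, mul_zero]
  have h3 : totalDeg m = ∑ k ∈ m.support, k * m k := rfl
  rw [h3, h2, ← Finset.sum_filter_add_sum_filter_not m.support (M < ·)]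
  exact Nat.add_le_add_right h1 _

lemma card_halfEdges_le (m : ℕ →₀ ℕ) (hm0 : m 0 = 0) :
    Fintype.card (HalfEdges m) ≤ totalDeg m := by
  have h := card_bigHalfEdges_add_le m hm0 0
  have h' : bigHalfEdges m 0 = Finset.univ :=
    Finset.filter_true_of_mem fun x _ => degOf_pos m hm0 x.1.2
  rw [h', Finset.card_univ] at h
  omega

lemma adj_eq_adjOff (m : ℕ →₀ ℕ) (f : HalfEdges m → HalfEdges m) :
    adj m f = AdjOff (fun x : HalfEdges m => x.1) f ∅ := by
  ext u v
  constructor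
  · rintro ⟨j, j', h⟩
    exact ⟨⟨u, j⟩, id, id, rfl, by rw [h]⟩
  · rintro ⟨⟨w, j⟩, -, -, rfl, rfl⟩
    exact ⟨j, (f ⟨w, j⟩).2, rfl⟩

/-- Simple configurations with a component that contains all vertices of degree at most `M`, up
to one vertex of degree one, are at most as numerous as connected simple configurations, up to
a factor exponential in the number of half-edges at vertices of larger degree. -/
lemma cScomp_le (m m' : ℕ →₀ ℕ) (M : ℕ) (hm0 : m 0 = 0)
    (h2 : ∀ i, 2 ≤ i → i ≤ M → m' i = m i) (h1 : m' 1 = m 1 ∨ m' 1 = m 1 - 1) :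
    cScomp m m' ≤ cSc m * (totalDeg m * 2 ^ (bigHalfEdges m M).card) := by
  classical
  let Φ : (HalfEdges m → HalfEdges m) × HalfEdges m × Finset (HalfEdges m) →
      (HalfEdges m → HalfEdges m) := fun t =>
    (cyclePerm (insert t.2.1 t.2.2)).symm ∘ t.1 ∘ cyclePerm (insert t.2.1 t.2.2)
  let T : Set ((HalfEdges m → HalfEdges m) × HalfEdges m × Finset (HalfEdges m)) :=
    {f | IsConfig m f ∧ IsSimple m f ∧ IsConn m f} ×ˢ (Set.univ : Set (HalfEdges m)) ×ˢ
      ((bigHalfEdges m M).powerset : Set (Finset (HalfEdges m)))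
  have hT : T.ncard = cSc m * (Fintype.card (HalfEdges m) * 2 ^ (bigHalfEdges m M).card) := by
    simp only [T, Set.ncard_prod, Set.ncard_univ, Set.ncard_coe_finset, Finset.card_powerset,
      Nat.card_eq_fintype_card, cSc]
  have hsub : {f | IsConfig m f ∧ IsSimple m f ∧ HasCompOfType m f m'} ⊆ Φ '' T := by
    rintro f ⟨⟨hinv, -⟩, ⟨hl, hmult⟩, a, ha⟩
    set π : HalfEdges m → Fin (numV m) := fun x => x.1
    have hcomp : ∀ u, u ∈ component m f a ↔ ConnOff π f ∅ a u := fun u => by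
      rw [component, Set.mem_ofPred_eq, adj_eq_adjOff]
    have hdiff : ∀ i, {u : Fin (numV m) | u ∉ component m f a ∧ degOf m (u : ℕ) = i}.ncard
        + m' i ≤ m i := by
      intro i
      rw [← ha i, compType, ← Set.ncard_union_eq]
      · refine le_trans ?_ (card_degOf_eq_le m hm0 i)
        rw [← Set.ncard_coe_finset]
        refine Set.ncard_le_ncard (fun u hu => ?_)
        simp only [Finset.coe_filter, Finset.mem_univ, true_and, Set.mem_ofPred_eq]
        rcases hu with hu | hu <;> exact hu.2
      · exact Set.disjoint_left.2 fun u hu hu' => hu.1 hu'.1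
    have hsmall : ∀ u, u ∉ component m f a → degOf m (u : ℕ) ≤ M → degOf m (u : ℕ) = 1 := by
      intro u hu hM'
      by_contra hne
      have hpos := degOf_pos m hm0 u.2
      have h := hdiff (degOf m (u : ℕ))
      rw [h2 _ (by omega) hM'] at h
      have h0 : {w : Fin (numV m) | w ∉ component m f a ∧
          degOf m (w : ℕ) = degOf m (u : ℕ)}.ncard = 0 := by omega
      rw [Set.ncard_eq_zero] at h0
      exact Set.notMem_empty u (h0 ▸ ⟨hu, rfl⟩)
    obtain ⟨r₀, hr₀⟩ : ∃ r₀, ∀ u, u ∉ component m f a → degOf m (u : ℕ) = 1 → u = r₀ := by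
      have hle : {u : Fin (numV m) | u ∉ component m f a ∧ degOf m (u : ℕ) = 1}.ncard ≤ 1 := by
        have := hdiff 1
        omega
      by_cases hex : ∃ r, r ∉ component m f a ∧ degOf m (r : ℕ) = 1
      · obtain ⟨r, hr⟩ := hex
        exact ⟨r, fun u hu hu' => (Set.ncard_le_one (Set.toFinite _)).1 hle u ⟨hu, hu'⟩ r hr⟩
      · exact ⟨a, fun u hu hu' => absurd ⟨u, hu, hu'⟩ hex⟩
    have hπ : Function.Surjective π := fun u => ⟨⟨u, ⟨0, degOf_pos m hm0 u.2⟩⟩, rfl⟩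
    obtain ⟨b, X, g, hX, hfg, hgi, hgl, hgm, hgc⟩ :=
      exists_conj_connected_simple π f hinv hl hmult hπ a r₀
        (fun u hu hur => by
          rw [← hcomp] at hu
          have hd : 1 < degOf m (u : ℕ) := by
            have hpos := degOf_pos m hm0 u.2
            have : degOf m (u : ℕ) ≠ 1 := fun h => hur (hr₀ u hu h)
            omega
          refine ⟨⟨u, ⟨0, by omega⟩⟩, ⟨u, ⟨1, hd⟩⟩, ?_, rfl, rfl⟩
          intro h
          simp at h)
        (bigHalfEdges m M)
        (fun x y hxy hπxy hx => by
          rw [← hcomp] at hx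
          refine Finset.mem_filter.2 ⟨Finset.mem_univ _, not_le.1 fun hle => hxy ?_⟩
          have hd := hsmall x.1 hx hle
          obtain ⟨u, j⟩ := x
          obtain ⟨v, j'⟩ := y
          obtain rfl : u = v := hπxy
          have : j = j' := by
            have hj := j.2
            have hj' := j'.2
            simp only at hd
            exact Fin.ext (by omega)
          rw [this])
    refine ⟨(g, b, X), ⟨⟨⟨hgi, fun x h => hgl x (congrArg π h)⟩, ⟨hgl, hgm⟩, fun u v => ?_⟩,
      Set.mem_univ _, Finset.mem_coe.2 (Finset.mem_powerset.2 hX)⟩, hfg.symm⟩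
    rw [adj_eq_adjOff]
    exact hgc u v
  calc cScomp m m' ≤ (Φ '' T).ncard := Set.ncard_le_ncard hsub
    _ ≤ T.ncard := Set.ncard_image_le
    _ ≤ _ := by
      rw [hT]
      gcongr
      exact card_halfEdges_le m hm0

end Counting

lemma totalDeg_typeOf (d : (n : ℕ) → Fin n → ℕ) (n : ℕ) : totalDeg (typeOf d n) = ℓTot d n := by
  rw [totalDeg, typeOf, ← Finsupp.sum_finsetSum_index (fun i => mul_zero i)
    (fun i b c => mul_add i b c)]
  simp [ℓTot]

lemma typeOf_zero (d : (n : ℕ) → Fin n → ℕ) (hdpos : ∀ n j, 0 < d n j) (n : ℕ) :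
    typeOf d n 0 = 0 := by
  rw [typeOf, Finsupp.finsetSum_apply]
  exact Finset.sum_eq_zero fun j _ => Finsupp.single_eq_of_ne (hdpos n j).ne

lemma tendsto_log_div_of_tendsto_div {a : ℕ → ℝ} {l : ℝ} (hl : 0 < l)
    (h : Filter.Tendsto (fun n : ℕ => a n / (n : ℝ)) Filter.atTop (nhds l)) :
    Filter.Tendsto (fun n : ℕ => Real.log (a n) / (n : ℝ)) Filter.atTop (nhds 0) := by
  have h1 : Filter.Tendsto (fun n : ℕ => Real.log (a n / n) / (n : ℝ)) Filter.atTop (nhds 0) :=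
    (h.log hl.ne').div_atTop tendsto_natCast_atTop_atTop
  have h2 : Filter.Tendsto (fun n : ℕ => Real.log (n : ℝ) / (n : ℝ)) Filter.atTop (nhds 0) :=
    Real.isLittleO_log_id_atTop.tendsto_div_nhds_zero.comp tendsto_natCast_atTop_atTop
  have h3 := h1.add h2
  rw [add_zero] at h3
  refine h3.congr' ?_
  filter_upwards [h.eventually_const_lt hl, Filter.eventually_gt_atTop 0] with n hn hn0
  have hn0' : (n : ℝ) ≠ 0 := by positivity
  have ha : a n ≠ 0 := by
    intro h
    simp [h] at hn
  rw [Real.log_div ha hn0']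
  ring

lemma le_liminf_of_eventually_le {u : ℕ → ℝ} {c : ℝ} (hc : c ≤ 0)
    (h : ∀ᶠ n in Filter.atTop, c ≤ u n) : c ≤ Filter.liminf u Filter.atTop := by
  rw [Filter.liminf_eq]
  by_cases hb : BddAbove {a | ∀ᶠ n in Filter.atTop, a ≤ u n}
  · exact le_csSup hb h
  · rwa [Real.sSup_of_not_bddAbove hb]

lemma neg_le_log_div {a b l H : ℕ} (h : b ≤ a * (l * 2 ^ H)) :
    -(Real.log l + H * Real.log 2) ≤ Real.log ((a : ℝ) / b) := by
  rcases Nat.eq_zero_or_pos b with rfl | hb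
  · have h1 : 0 ≤ Real.log (l : ℝ) := Real.log_natCast_nonneg l
    have h2 : 0 ≤ Real.log (2 : ℝ) := Real.log_nonneg (by norm_num)
    have h3 : 0 ≤ (H : ℝ) * Real.log 2 := by positivity
    simp only [Nat.cast_zero, div_zero, Real.log_zero]
    linarith
  · have hpos : 0 < a * (l * 2 ^ H) := hb.trans_le h
    have ha : 0 < a := Nat.pos_of_mul_pos_right hpos
    have hl : 0 < l := Nat.pos_of_mul_pos_right (Nat.pos_of_mul_pos_left hpos)
    have ha' : (0 : ℝ) < a := by exact_mod_cast ha
    have hb' : (0 : ℝ) < b := by exact_mod_cast hb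
    have hl' : (0 : ℝ) < l := by exact_mod_cast hl
    have h' : (b : ℝ) ≤ a * (l * 2 ^ H) := by exact_mod_cast h
    have h4 := Real.log_le_log hb' h'
    rw [Real.log_mul ha'.ne' (by positivity), Real.log_mul hl'.ne' (by positivity),
      Real.log_pow] at h4
    rw [Real.log_div ha'.ne' hb'.ne']
    linarith

/-- Proposition 5.1 of the paper: controlling the truncation of the
degree sequence: `|𝒮c_{n(n)}| ≥ e^{δ(ε)n}·|𝒮_{n(n)}^{n^ε}|` with `δ(ε) → 0` as `ε ↓ 0`,
where `n^ε` is the truncation of `n(n)` at level `M = M(ε)` (with `n_1` decreased by `1`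
if necessary to make the total degree even). -/
theorem truncation_control
    (d : (n : ℕ) → Fin n → ℕ) (p : ℕ → ℝ)
    (hdpos : ∀ n j, 0 < d n j) (hdeven : ∀ n, Even (ℓTot d n))
    (hp0 : p 0 = 0) (hpnn : ∀ i, 0 ≤ p i) (hpsum : ∑' i : ℕ, p i = 1)
    (ha : ∀ i : ℕ, Filter.Tendsto (fun n : ℕ => (typeOf d n i : ℝ) / (n : ℝ))
      Filter.atTop (nhds (p i)))
    (hmom : Summable fun i : ℕ => (i : ℝ) * p i)
    (hb : Filter.Tendsto (fun n : ℕ => (ℓTot d n : ℝ) / (n : ℝ)) Filter.atTop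
      (nhds (∑' i : ℕ, (i : ℝ) * p i)))
    (hP1 : 0 < p 1) (hP2 : 2 < ∑' i : ℕ, (i : ℝ) * p i) :
    ∃ ε' : ℝ, 0 < ε' ∧ ∀ η : ℝ, 0 < η → ∃ ε'' : ℝ, (0 < ε'' ∧ ε'' ≤ ε') ∧
      ∀ ε : ℝ, 0 < ε → ε < ε'' →
      ∀ M : ℕ, (∑' k : ℕ, ((k + M + 1 : ℕ) : ℝ) * p (k + M + 1)) < ε / 2 →
      ∀ tr : ℕ → (ℕ →₀ ℕ),
        (∀ n : ℕ, ∀ i : ℕ, 2 ≤ i → i ≤ M → tr n i = typeOf d n i) →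
        (∀ n : ℕ, ∀ i : ℕ, M < i → tr n i = 0) →
        (∀ n : ℕ, tr n 0 = 0) →
        (∀ n : ℕ, tr n 1 = typeOf d n 1 ∨ tr n 1 = typeOf d n 1 - 1) →
        (∀ n : ℕ, Even (totalDeg (tr n))) →
        -η ≤ Filter.liminf (fun n : ℕ =>
            (1 / (n : ℝ)) * Real.log
              ((cSc (typeOf d n) : ℝ) / (cScomp (typeOf d n) (tr n) : ℝ)))
          Filter.atTop := by
  refine ⟨1, one_pos, fun η hη => ⟨min 1 η, ⟨lt_min one_pos hη, min_le_left _ _⟩, ?_⟩⟩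
  intro ε hε hεlt M hM tr htr _ _ htr1 _
  have hε1 : ε < 1 := hεlt.trans_le (min_le_left _ _)
  have hεη : ε < η := hεlt.trans_le (min_le_right _ _)
  have htail : ∑ k ∈ Finset.range (M + 1), (k : ℝ) * p k +
      ∑' k : ℕ, ((k + M + 1 : ℕ) : ℝ) * p (k + M + 1) = ∑' k : ℕ, (k : ℝ) * p k :=
    hmom.sum_add_tsum_nat_add (M + 1)
  have hlim : Filter.Tendsto (fun n : ℕ => (ℓTot d n : ℝ) / (n : ℝ) -
      ∑ k ∈ Finset.range (M + 1), (k : ℝ) * ((typeOf d n k : ℝ) / (n : ℝ))) Filter.atTop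
      (nhds (∑' k : ℕ, (k : ℝ) * p k - ∑ k ∈ Finset.range (M + 1), (k : ℝ) * p k)) :=
    hb.sub (tendsto_finsetSum _ fun k _ => (ha k).const_mul _)
  have hlog := tendsto_log_div_of_tendsto_div (by linarith) hb
  refine le_liminf_of_eventually_le (by linarith) ?_
  filter_upwards [hlim.eventually_lt_const (u := ε / 2) (by linarith),
    hlog.eventually_lt_const (half_pos hε), Filter.eventually_gt_atTop 0] with n hn1 hn2 hn0
  have hn0' : (0 : ℝ) < n := by exact_mod_cast hn0
  have hm0 := typeOf_zero d hdpos n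
  have hcount := cScomp_le (typeOf d n) (tr n) M hm0 (htr n) (htr1 n)
  have hbig := card_bigHalfEdges_add_le (typeOf d n) hm0 M
  rw [totalDeg_typeOf] at hcount hbig
  have hlogle := neg_le_log_div hcount
  set K := (bigHalfEdges (typeOf d n) M).card
  have hbig' : (K : ℝ) + ∑ k ∈ Finset.range (M + 1), (k : ℝ) * (typeOf d n k : ℝ) ≤ ℓTot d n := by
    exact_mod_cast hbig
  have hK : (K : ℝ) / n < ε / 2 := by
    refine lt_of_le_of_lt ?_ hn1
    simp only [← mul_div_assoc]
    rw [← Finset.sum_div, ← sub_div]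
    gcongr
    linarith
  rw [div_lt_iff₀ hn0'] at hK hn2
  have hlog2 : Real.log 2 ≤ 1 := by
    have := Real.log_two_lt_d9
    linarith
  have hKlog : (K : ℝ) * Real.log 2 ≤ K := mul_le_of_le_one_right (Nat.cast_nonneg K) hlog2
  rw [one_div, ← div_eq_inv_mul, le_div_iff₀ hn0']
  have := mul_lt_mul_of_pos_right hεη hn0'
  linarith

end PaperCM
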